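/- (Neural Approximation Theorem.) Let σ : ℝ → ℝ be a continuous function that is not affine and that is differentiable at at least one point with nonzero derivative there. Then for every continuous multivariate function ψ : [0,1]^n → ℝ and every desired accuracy ε > 0, there exist a natural number T, ranks R_1^j, …, R_n^j ∈ ℕ, coefficient tensors C^j ∈ ℝ^{R_1^j × ⋯ × R_n^j}, and multilayer perceptrons f_{θ_i^j} : [0,1] → ℝ^{R_i^j} with activation σ (for i = 1, …, n and j = 1, …, T), such that sup_{x ∈ [0,1]^n} |ψ(x) − f_Θ(x)| < ε, where f_Θ(x) = ∑_{j=1}^T ∑_{k_1=1}^{R_1^j} ⋯ ∑_{k_n=1}^{R_n^j} C^j_{k_1,…,k_n} ∏_{i=1}^n (f_{θ_i^j}(x_i))_{k_i} for x = (x_1, …, x_n) ∈ [0,1]^n. -/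

import Mathlib

/-- A multilayer perceptron with activation `σ`: an alternating composition of
affine maps `x ↦ W x + b` and the componentwise application of `σ`, beginning
and ending with an affine map. -/
inductive IsMLP (σ : ℝ → ℝ) : {a b : ℕ} → ((Fin a → ℝ) → (Fin b → ℝ)) → Prop
  | affine {a b : ℕ} (W : Matrix (Fin b) (Fin a) ℝ) (v : Fin b → ℝ) :
      IsMLP σ (fun x => W.mulVec x + v)
  | layer {a b c : ℕ} (W : Matrix (Fin c) (Fin b) ℝ) (v : Fin c → ℝ)
      {F : (Fin a → ℝ) → (Fin b → ℝ)} (hF : IsMLP σ F) :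
      IsMLP σ (fun x => W.mulVec (fun i => σ (F x i)) + v)

namespace IsMLP

variable {σ : ℝ → ℝ}

theorem comp_affine {a b c : ℕ} {F : (Fin a → ℝ) → (Fin b → ℝ)} (hF : IsMLP σ F)
    (W : Matrix (Fin c) (Fin b) ℝ) (v : Fin c → ℝ) :
    IsMLP σ (fun x => W.mulVec (F x) + v) := by
  cases hF with
  | affine W' v' =>
    simpa [Matrix.mulVec_add, add_assoc] using IsMLP.affine (σ := σ) (W * W') (W.mulVec v' + v)
  | layer W' v' hF' =>
    simpa [Matrix.mulVec_add, add_assoc] using IsMLP.layer (W * W') (W.mulVec v' + v) hF'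

theorem comp {a b c : ℕ} {G : (Fin b → ℝ) → (Fin c → ℝ)} {F : (Fin a → ℝ) → (Fin b → ℝ)}
    (hG : IsMLP σ G) (hF : IsMLP σ F) : IsMLP σ (fun x => G (F x)) := by
  induction hG with
  | affine W v => exact hF.comp_affine W v
  | layer W v _ ih => exact .layer W v ih

theorem continuous (hσ : Continuous σ) {a b : ℕ} {F : (Fin a → ℝ) → (Fin b → ℝ)}
    (hF : IsMLP σ F) : Continuous F := by
  induction hF with
  | affine W v => fun_prop
  | layer W v _ ih => fun_prop

end IsMLP

/-- The scalar function `g` is computed by a multilayer perceptron with one input and one output. -/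
def IsScalarMLP (σ : ℝ → ℝ) (g : ℝ → ℝ) : Prop :=
  ∃ F : (Fin 1 → ℝ) → (Fin 1 → ℝ), IsMLP σ F ∧ ∀ t, F (fun _ => t) 0 = g t

namespace IsScalarMLP

variable {σ : ℝ → ℝ}

theorem affine (w b : ℝ) : IsScalarMLP σ (fun t => w * t + b) :=
  ⟨_, .affine (Matrix.of fun _ _ => w) (fun _ => b), fun t => by
    simp [Matrix.mulVec, dotProduct]⟩

theorem comp {g f : ℝ → ℝ} (hg : IsScalarMLP σ g) (hf : IsScalarMLP σ f) :
    IsScalarMLP σ (fun t => g (f t)) := by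
  obtain ⟨G, hG, hGg⟩ := hg
  obtain ⟨F, hF, hFf⟩ := hf
  refine ⟨_, hG.comp hF, fun t => ?_⟩
  dsimp only
  rw [← hGg, ← hFf]
  congr 2
  ext i
  rw [Subsingleton.elim i 0]

theorem shallow {N : ℕ} (c w b : Fin N → ℝ) :
    IsScalarMLP σ (fun t => ∑ i, c i * σ (w i * t + b i)) :=
  ⟨_, .layer (Matrix.of fun _ i => c i) 0 (.affine (Matrix.of fun i _ => w i) b), fun t => by
    simp [Matrix.mulVec, dotProduct]⟩

theorem continuous (hσ : Continuous σ) {g : ℝ → ℝ} (hg : IsScalarMLP σ g) : Continuous g := by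
  obtain ⟨F, hF, hFg⟩ := hg
  have := hF.continuous hσ
  rw [← funext hFg]
  fun_prop

end IsScalarMLP

theorem exists_second_difference_ne_zero {σ : ℝ → ℝ} (hσ : Continuous σ)
    (hna : ¬ ∃ a b : ℝ, ∀ t : ℝ, σ t = a * t + b) :
    ∃ x h : ℝ, σ (x + h + h) - σ (x + h) - (σ (x + h) - σ x) ≠ 0 := by
  by_contra! H
  have hdouble (x : ℝ) : σ (x + x) - σ 0 = 2 * (σ x - σ 0) := by
    have := H 0 x
    simp only [zero_add] at this
    linarith
  have hadd (x y : ℝ) : σ (x + y) - σ 0 = (σ x - σ 0) + (σ y - σ 0) := by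
    have h1 := H x ((y - x) / 2)
    have h2 := hdouble ((x + y) / 2)
    ring_nf at h1 h2 ⊢
    linarith
  let f : ℝ →+ ℝ := AddMonoidHom.mk' (fun x => σ x - σ 0) hadd
  let L := f.toRealLinearMap (show Continuous fun x => σ x - σ 0 by fun_prop)
  refine hna ⟨L 1, σ 0, fun t => ?_⟩
  have h1 : L t = t * L 1 := by simpa using L.map_smul t 1
  have h2 : L t = σ t - σ 0 := rfl
  linarith

/-- The integral `∫ s in 0..h, g (x + s)`, a mollification of `g`. -/
noncomputable def windowIntegral (h : ℝ) (g : ℝ → ℝ) (x : ℝ) : ℝ :=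
  ∫ s in (0 : ℝ)..h, g (x + s)

theorem hasDerivAt_windowIntegral {g : ℝ → ℝ} (hg : Continuous g) (h x : ℝ) :
    HasDerivAt (windowIntegral h g) (g (x + h) - g x) x := by
  have hP (y : ℝ) : HasDerivAt (fun z => ∫ s in (0 : ℝ)..z, g s) (g y) y :=
    intervalIntegral.integral_hasDerivAt_right (hg.intervalIntegrable _ _)
      hg.aestronglyMeasurable.stronglyMeasurableAtFilter hg.continuousAt
  have heq : windowIntegral h g =
      fun y => (∫ s in (0 : ℝ)..y + h, g s) - ∫ s in (0 : ℝ)..y, g s := by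
    ext y
    rw [windowIntegral, intervalIntegral.integral_comp_add_left, add_zero,
      intervalIntegral.integral_interval_sub_left] <;> exact hg.intervalIntegrable _ _
  rw [heq]
  exact ((hP (x + h)).comp_add_const x h).sub (hP x)

theorem continuous_windowIntegral {g : ℝ → ℝ} (hg : Continuous g) (h : ℝ) :
    Continuous (windowIntegral h g) :=
  continuous_iff_continuousAt.2 fun x => (hasDerivAt_windowIntegral hg h x).continuousAt

theorem exists_abs_symmetric_second_difference_le {f f' : ℝ → ℝ} {x₀ c : ℝ}
    (hf : ∀ x, HasDerivAt f (f' x) x) (hf' : HasDerivAt f' c x₀) {ε : ℝ} (hε : 0 < ε) :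
    ∃ δ > 0, ∀ v, |v| < δ → |f (x₀ + v) + f (x₀ - v) - 2 * f x₀ - c * v ^ 2| ≤ ε * v ^ 2 := by
  have h1 := (hasDerivAt_iff_isLittleO_nhds_zero.1 hf').def (half_pos hε)
  obtain ⟨δ, hδ, hball⟩ := Metric.eventually_nhds_iff.1 h1
  refine ⟨δ, hδ, fun v hv => ?_⟩
  let G : ℝ → ℝ := fun v => f (x₀ + v) + f (x₀ - v) - 2 * f x₀ - c * v ^ 2
  have hG (w : ℝ) : HasDerivAt G (f' (x₀ + w) - f' (x₀ - w) - 2 * c * w) w := by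
    have h2 := ((hf (x₀ + w)).comp_const_add x₀ w).add ((hf (x₀ - w)).comp_const_sub x₀ w)
    convert! (h2.sub_const (2 * f x₀)).sub ((hasDerivAt_pow 2 w).const_mul c) using 1
    simp
    ring
  have hbound (w : ℝ) (hw : w ∈ Metric.closedBall (0 : ℝ) |v|) :
      ‖f' (x₀ + w) - f' (x₀ - w) - 2 * c * w‖ ≤ ε * |v| := by
    have hwv : |w| ≤ |v| := by simpa using hw
    have h3 := hball (y := w) (by simpa using hwv.trans_lt hv)
    have h4 := hball (y := -w) (by simpa using hwv.trans_lt hv)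
    simp only [Real.norm_eq_abs, smul_eq_mul, abs_neg, ← sub_eq_add_neg] at h3 h4 ⊢
    have h5 : f' (x₀ + w) - f' (x₀ - w) - 2 * c * w =
        (f' (x₀ + w) - f' x₀ - w * c) - (f' (x₀ - w) - f' x₀ - -w * c) := by ring
    rw [h5]
    refine (abs_sub _ _).trans ?_
    nlinarith
  have h6 := (convex_closedBall (0 : ℝ) |v|).norm_image_sub_le_of_norm_hasDerivWithin_le
    (fun w _ => (hG w).hasDerivWithinAt) hbound (x := 0) (y := v) (by simp) (by simp)
  have h7 : G 0 = 0 := by simp [G]; ring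
  rw [h7] at h6
  simpa [G, mul_assoc, ← sq] using h6

section AffineOrbit

variable {X : Type*} [TopologicalSpace X]

/-- The subspace `V` of `C(X, ℝ)` contains all functions `x ↦ g (w * u x + b)`. -/
def ContainsAffineOrbit (V : Submodule ℝ C(X, ℝ)) (u : C(X, ℝ)) (g : ℝ → ℝ) : Prop :=
  ∀ (w b : ℝ) (F : C(X, ℝ)), (∀ x, F x = g (w * u x + b)) → F ∈ V

variable [CompactSpace X] {V : Submodule ℝ C(X, ℝ)} {u : C(X, ℝ)}

theorem Submodule.intervalIntegral_mem {E : Type*} [NormedAddCommGroup E] [NormedSpace ℝ E]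
    [CompleteSpace E] {V : Submodule ℝ E} (hV : IsClosed (V : Set E)) {G : ℝ → E}
    (hG : Continuous G) (hGV : ∀ s, G s ∈ V) (a b : ℝ) : ∫ s in a..b, G s ∈ V := by
  have : CompleteSpace V := hV.completeSpace_coe
  have hcont : Continuous (fun s => (⟨G s, hGV s⟩ : V)) := hG.subtype_mk hGV
  have := V.subtypeL.intervalIntegral_comp_comm
    (hcont.intervalIntegrable (μ := MeasureTheory.volume) a b)
  simp only [Submodule.subtypeL_apply] at this
  rw [this]
  exact Submodule.coe_mem _

theorem ContainsAffineOrbit.windowIntegral (hV : IsClosed (V : Set C(X, ℝ))) {g : ℝ → ℝ}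
    (hg : Continuous g) (h : ContainsAffineOrbit V u g) (l : ℝ) :
    ContainsAffineOrbit V u (windowIntegral l g) := by
  intro w b F hF
  let G : C(ℝ, C(X, ℝ)) :=
    ContinuousMap.curry ⟨fun p : ℝ × X => g (w * u p.2 + b + p.1), by fun_prop⟩
  have hGs (s : ℝ) (x : X) : G s x = g (w * u x + b + s) := rfl
  have : F = ∫ s in (0 : ℝ)..l, G s := by
    ext x
    have h1 := (ContinuousMap.evalCLM ℝ x).intervalIntegral_comp_comm
      (G.continuous.intervalIntegrable (μ := MeasureTheory.volume) 0 l)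
    simp only [ContinuousMap.evalCLM_apply] at h1
    rw [← h1, hF]
    rfl
  rw [this]
  refine Submodule.intervalIntegral_mem hV G.continuous (fun s => ?_) 0 l
  exact h w (b + s) _ fun x => by rw [hGs, add_assoc]

theorem ContainsAffineOrbit.sq_mem (hV : IsClosed (V : Set C(X, ℝ))) {f f' : ℝ → ℝ} {x₀ c : ℝ}
    (h : ContainsAffineOrbit V u f) (hf : ∀ x, HasDerivAt f (f' x) x)
    (hf' : HasDerivAt f' c x₀) (hc : c ≠ 0) : u ^ 2 ∈ V := by
  have hcont : Continuous f := continuous_iff_continuousAt.2 fun x => (hf x).continuousAt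
  suffices c • u ^ 2 ∈ V by simpa [hc] using V.smul_mem c⁻¹ this
  rw [← SetLike.mem_coe, ← hV.closure_eq, Metric.mem_closure_iff]
  intro ε hε
  have hK : 0 < ‖u‖ + 1 := by positivity
  obtain ⟨δ, hδ, hδf⟩ := exists_abs_symmetric_second_difference_le hf hf'
    (show 0 < ε / 2 / (‖u‖ + 1) ^ 2 by positivity)
  obtain ⟨η, hη, hηδ⟩ : ∃ η > 0, η * (‖u‖ + 1) < δ :=
    ⟨δ / 2 / (‖u‖ + 1), by positivity, by rw [div_mul_cancel₀ _ hK.ne']; linarith⟩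
  let S (w : ℝ) : C(X, ℝ) := ⟨fun x => f (w * u x + x₀), by fun_prop⟩
  have hS (w : ℝ) : S w ∈ V := h w x₀ _ fun x => rfl
  refine ⟨(η ^ 2)⁻¹ • (S η + S (-η) - (2 : ℝ) • S 0),
    V.smul_mem _ (V.sub_mem (V.add_mem (hS _) (hS _)) (V.smul_mem _ (hS _))), ?_⟩
  refine ((ContinuousMap.dist_le (half_pos hε).le).2 fun x => ?_).trans_lt (half_lt_self hε)
  have hux : |u x| ≤ ‖u‖ := u.norm_coe_le_norm x
  have h1 := hδf (η * u x) (by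
    rw [abs_mul, abs_of_pos hη]
    exact lt_of_le_of_lt (by gcongr; linarith) hηδ)
  have h2 : (u x) ^ 2 ≤ (‖u‖ + 1) ^ 2 := sq_le_sq' (by linarith [abs_le.1 hux])
    (by linarith [abs_le.1 hux])
  have h3 : dist ((c • u ^ 2) x) (((η ^ 2)⁻¹ • (S η + S (-η) - (2 : ℝ) • S 0)) x) =
      (η ^ 2)⁻¹ * |f (x₀ + η * u x) + f (x₀ - η * u x) - 2 * f x₀ - c * (η * u x) ^ 2| := by
    rw [dist_comm, Real.dist_eq, ← abs_of_pos (show 0 < (η ^ 2)⁻¹ by positivity), ← abs_mul,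
      abs_of_pos (show 0 < (η ^ 2)⁻¹ by positivity)]
    congr 1
    simp only [S, ContinuousMap.smul_apply, ContinuousMap.sub_apply, ContinuousMap.add_apply,
      ContinuousMap.coe_mk, ContinuousMap.pow_apply, smul_eq_mul]
    rw [show η * u x + x₀ = x₀ + η * u x by ring, show -η * u x + x₀ = x₀ - η * u x by ring,
      show 0 * u x + x₀ = x₀ by ring]
    field_simp
  rw [h3]
  calc _ ≤ (η ^ 2)⁻¹ * (ε / 2 / (‖u‖ + 1) ^ 2 * (η * u x) ^ 2) := by gcongr
    _ = ε / 2 * ((u x) ^ 2 / (‖u‖ + 1) ^ 2) := by field_simp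
    _ ≤ ε / 2 * 1 := by gcongr; exact div_le_one_of_le₀ h2 (by positivity)
    _ = ε / 2 := mul_one _

end AffineOrbit

theorem exists_isScalarMLP_near_sq {σ : ℝ → ℝ} (hσ : Continuous σ)
    (hna : ¬ ∃ a b : ℝ, ∀ t : ℝ, σ t = a * t + b) (K : ℝ) {ε : ℝ} (hε : 0 < ε) :
    ∃ s : ℝ → ℝ, IsScalarMLP σ s ∧ ∀ t, |t| ≤ K → |s t - t ^ 2| < ε := by
  obtain ⟨x, h, hxh⟩ := exists_second_difference_ne_zero hσ hna
  let X := Set.Icc (-K) K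
  let u : C(X, ℝ) := ⟨fun t => t, by fun_prop⟩
  let ridge (p : ℝ × ℝ) : C(X, ℝ) := ⟨fun t => σ (p.1 * t + p.2), by fun_prop⟩
  let S : Submodule ℝ C(X, ℝ) := Submodule.span ℝ (Set.range ridge)
  have hcl : IsClosed (S.topologicalClosure : Set C(X, ℝ)) := S.isClosed_topologicalClosure
  have horbit : ContainsAffineOrbit S.topologicalClosure u σ := fun w b F hF =>
    S.le_topologicalClosure (Submodule.subset_span ⟨(w, b), by ext t; exact (hF t).symm⟩)
  have hσ' := continuous_windowIntegral hσ h
  have hsq : u ^ 2 ∈ S.topologicalClosure :=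
    ((horbit.windowIntegral hcl hσ h).windowIntegral hcl hσ' h).sq_mem hcl
      (fun y => hasDerivAt_windowIntegral hσ' h y)
      (((hasDerivAt_windowIntegral hσ h (x + h)).comp_add_const x h).sub
        (hasDerivAt_windowIntegral hσ h x)) hxh
  obtain ⟨F, hFS, hF⟩ := Metric.mem_closure_iff.1 hsq ε hε
  obtain ⟨N, c, p, rfl⟩ := Submodule.mem_span_set'.1 hFS
  choose q hq using fun i => (p i).2
  refine ⟨_, IsScalarMLP.shallow c (fun i => (q i).1) (fun i => (q i).2), fun t ht => ?_⟩
  have h1 := (ContinuousMap.dist_apply_le_dist (⟨t, abs_le.1 ht⟩ : X)).trans_lt hF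
  rw [dist_comm, Real.dist_eq] at h1
  simpa [← hq, ridge, u] using h1

section UnitInterval

variable {σ : ℝ → ℝ}

/-- Continuous functions on the unit interval computed by a scalar multilayer perceptron. -/
def scalarMLPs (σ : ℝ → ℝ) : Set C(unitInterval, ℝ) :=
  {g | ∃ f : ℝ → ℝ, IsScalarMLP σ f ∧ ∀ t : unitInterval, g t = f t}

theorem sq_mem_closure_scalarMLPs (hσ : Continuous σ)
    (hna : ¬ ∃ a b : ℝ, ∀ t : ℝ, σ t = a * t + b) {g : C(unitInterval, ℝ)}
    (hg : g ∈ closure (scalarMLPs σ)) : g ^ 2 ∈ closure (scalarMLPs σ) := by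
  have hmaps : Set.MapsTo (fun g : C(unitInterval, ℝ) => g ^ 2) (scalarMLPs σ)
      (closure (scalarMLPs σ)) := by
    rintro g ⟨f, hf, hgf⟩
    rw [Metric.mem_closure_iff]
    intro ε hε
    obtain ⟨s, hs, hsq⟩ := exists_isScalarMLP_near_sq hσ hna ‖g‖ (half_pos hε)
    have hsf := hs.comp hf
    refine ⟨⟨fun t : unitInterval => s (f t),
      (hsf.continuous hσ).comp continuous_subtype_val⟩, ⟨_, hsf, fun t => rfl⟩, ?_⟩
    refine ((ContinuousMap.dist_le (half_pos hε).le).2 fun t => ?_).trans_lt (half_lt_self hε)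
    have := hsq (g t) (g.norm_coe_le_norm t)
    rw [dist_comm, Real.dist_eq]
    simpa [← hgf] using this.le
  exact closure_minimal hmaps.image_subset isClosed_closure
    (image_closure_subset_closure_image (by fun_prop) ⟨g, hg, rfl⟩)

theorem affine_pow_mem_closure_scalarMLPs (hσ : Continuous σ)
    (hna : ¬ ∃ a b : ℝ, ∀ t : ℝ, σ t = a * t + b) (b : ℝ) (m : ℕ) :
    ((⟨fun t : unitInterval => (t : ℝ) + b, by fun_prop⟩ : C(unitInterval, ℝ)) ^ 2 ^ m) ∈
      closure (scalarMLPs σ) := by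
  induction m with
  | zero => exact subset_closure ⟨_, IsScalarMLP.affine 1 b, fun t => by simp⟩
  | succ m ih =>
    rw [pow_succ, pow_mul]
    exact sq_mem_closure_scalarMLPs hσ hna ih

theorem pow_mem_of_forall_add_pow_mem {A : Type*} [CommRing A] [Algebra ℝ A]
    (V : Submodule ℝ A) (x : A) {N k : ℕ} (hk : k ≤ N)
    (h : ∀ b : ℝ, (x + algebraMap ℝ A b) ^ N ∈ V) : x ^ k ∈ V := by
  by_contra hx
  obtain ⟨L, hLx, hLV⟩ := Submodule.exists_le_ker_of_notMem hx
  let p : Polynomial ℝ := ∑ j ∈ Finset.range (N + 1),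
    Polynomial.monomial (N - j) (L (x ^ j) * N.choose j)
  have hp : p = 0 := Polynomial.funext fun b => by
    have h1 : L ((x + algebraMap ℝ A b) ^ N) = 0 := hLV (h b)
    rw [add_pow, map_sum] at h1
    rw [Polynomial.eval_zero, ← h1, Polynomial.eval_finsetSum]
    refine Finset.sum_congr rfl fun j _ => ?_
    have h2 : x ^ j * algebraMap ℝ A b ^ (N - j) * (N.choose j : A) =
        (b ^ (N - j) * (N.choose j : ℝ)) • x ^ j := by
      rw [Algebra.smul_def]
      simp only [map_mul, map_pow, map_natCast]
      ring
    rw [h2, map_smul, Polynomial.eval_monomial, smul_eq_mul]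
    ring
  have h3 : p.coeff (N - k) = L (x ^ k) * N.choose k := by
    simp only [p, Polynomial.finsetSum_coeff, Polynomial.coeff_monomial]
    rw [Finset.sum_eq_single k]
    · simp
    · intro j hj hjk
      have := Finset.mem_range.1 hj
      rw [if_neg (by omega)]
    · intro hk'
      exact absurd (Finset.mem_range.2 (by omega)) hk'
  rw [hp, Polynomial.coeff_zero, eq_comm, mul_eq_zero] at h3
  exact h3.elim hLx (by exact_mod_cast (Nat.choose_pos hk).ne')

theorem topologicalClosure_span_scalarMLPs (hσ : Continuous σ)
    (hna : ¬ ∃ a b : ℝ, ∀ t : ℝ, σ t = a * t + b) :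
    (Submodule.span ℝ (scalarMLPs σ)).topologicalClosure = ⊤ := by
  set V := (Submodule.span ℝ (scalarMLPs σ)).topologicalClosure
  have hV : closure (scalarMLPs σ) ⊆ V := closure_mono Submodule.subset_span
  have hpow (k : ℕ) : (⟨fun t : unitInterval => (t : ℝ), by fun_prop⟩ : C(unitInterval, ℝ)) ^ k ∈
      V := by
    refine pow_mem_of_forall_add_pow_mem V _ (Nat.lt_two_pow_self (n := k)).le fun b => ?_
    exact hV (affine_pow_mem_closure_scalarMLPs hσ hna b k)
  have hpoly : (polynomialFunctions unitInterval : Set C(unitInterval, ℝ)) ⊆ V := by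
    rintro _ ⟨p, -, rfl⟩
    induction p using Polynomial.induction_on' with
    | add p q hp hq =>
      rw [RingHom.coe_coe, map_add]
      exact V.add_mem hp hq
    | monomial k c =>
      convert! V.smul_mem c (hpow k) using 1
      ext t
      simp
  have hclosed : IsClosed (V : Set C(unitInterval, ℝ)) := Submodule.isClosed_topologicalClosure _
  refine top_unique fun g _ => closure_minimal hpoly hclosed ?_
  have : g ∈ (polynomialFunctions unitInterval).topologicalClosure := by
    rw [polynomialFunctions_closure_eq_top']
    trivial
  exact this

/-- The projection from the cube to its `i`-th coordinate. -/
def cubeProj (n : ℕ) (i : Fin n) : C(Set.Icc (0 : Fin n → ℝ) 1, unitInterval) where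
  toFun x := ⟨x.1 i, x.2.1 i, x.2.2 i⟩
  continuous_toFun := ((continuous_apply i).comp continuous_subtype_val).subtype_mk _

/-- The product function `x ↦ ∏ i, g i (x i)` on the cube. -/
def tensorProd {n : ℕ} (g : Fin n → C(unitInterval, ℝ)) : C(Set.Icc (0 : Fin n → ℝ) 1, ℝ) :=
  ∏ i, (g i).comp (cubeProj n i)

theorem continuous_tensorProd {n : ℕ} :
    Continuous (tensorProd : (Fin n → C(unitInterval, ℝ)) → C(Set.Icc (0 : Fin n → ℝ) 1, ℝ)) :=
  continuous_finsetProd _ fun i _ =>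
    (ContinuousMap.continuous_precomp (cubeProj n i)).comp (continuous_apply i)

theorem Submodule.prod_mem_prod {R A ι : Type*} [CommSemiring R] [CommSemiring A] [Algebra R A]
    (s : Finset ι) {M : ι → Submodule R A} {a : ι → A} (h : ∀ i ∈ s, a i ∈ M i) :
    ∏ i ∈ s, a i ∈ ∏ i ∈ s, M i := by
  classical
  induction s using Finset.induction_on with
  | empty => exact Submodule.one_le.1 le_rfl
  | insert i s hi ih =>
    rw [Finset.prod_insert hi, Finset.prod_insert hi]
    exact Submodule.mul_mem_mul (h i (Finset.mem_insert_self i s))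
      (ih fun j hj => h j (Finset.mem_insert_of_mem hj))

theorem tensorProd_mem_span {n : ℕ} {s : Set C(unitInterval, ℝ)} {g : Fin n → C(unitInterval, ℝ)}
    (hg : ∀ i, g i ∈ Submodule.span ℝ s) :
    tensorProd g ∈ Submodule.span ℝ (tensorProd '' Set.univ.pi fun _ : Fin n => s) := by
  let φ (i : Fin n) := (ContinuousMap.compRightAlgHom ℝ ℝ (cubeProj n i)).toLinearMap
  have h1 : tensorProd g ∈ ∏ i, Submodule.span ℝ (φ i '' s) := by
    refine Submodule.prod_mem_prod Finset.univ (a := fun i => φ i (g i)) fun i _ => ?_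
    rw [← Submodule.map_span]
    exact Submodule.mem_map_of_mem (hg i)
  rw [Submodule.prod_span] at h1
  refine Submodule.span_mono ?_ h1
  intro F hF
  obtain ⟨f, hf, rfl⟩ := (Set.mem_fintype_prod _ _).1 hF
  choose g' hg' hg'f using hf
  exact ⟨g', fun i _ => hg' i, Finset.prod_congr rfl fun i _ => hg'f i⟩

theorem topologicalClosure_span_range_tensorProd (n : ℕ) :
    (Submodule.span ℝ (Set.range (tensorProd (n := n)))).topologicalClosure = ⊤ := by
  let M : Submonoid C(Set.Icc (0 : Fin n → ℝ) 1, ℝ) :=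
    { carrier := Set.range tensorProd
      one_mem' := ⟨1, by simp [tensorProd, ContinuousMap.one_comp]⟩
      mul_mem' := by
        rintro _ _ ⟨g, rfl⟩ ⟨h, rfl⟩
        exact ⟨g * h, by simp [tensorProd, ContinuousMap.mul_comp, Finset.prod_mul_distrib]⟩ }
  let A : Subalgebra ℝ C(Set.Icc (0 : Fin n → ℝ) 1, ℝ) := Algebra.adjoin ℝ M
  have hA : A.toSubmodule = Submodule.span ℝ (Set.range (tensorProd (n := n))) := by
    rw [Algebra.adjoin_eq_span, Submonoid.closure_eq]
    rfl
  have hsep : A.SeparatesPoints := by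
    intro x y hxy
    obtain ⟨i, hi⟩ : ∃ i, x.1 i ≠ y.1 i := by
      by_contra! h
      exact hxy (Subtype.ext (funext h))
    let c : C(unitInterval, ℝ) := ⟨fun t => t, by fun_prop⟩
    refine ⟨_, ⟨tensorProd (Pi.mulSingle i c), Algebra.subset_adjoin ⟨_, rfl⟩, rfl⟩, ?_⟩
    have h1 : tensorProd (Pi.mulSingle i c) = c.comp (cubeProj n i) := by
      rw [tensorProd, Finset.prod_eq_single i]
      · simp
      · intro j _ hj
        simp [hj, ContinuousMap.one_comp]
      · simp
    rw [h1]
    exact hi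
  have htop := ContinuousMap.subalgebra_topologicalClosure_eq_top_of_separatesPoints A hsep
  rw [← hA]
  refine top_unique fun F _ => ?_
  have : F ∈ A.topologicalClosure := htop ▸ trivial
  exact this

theorem topologicalClosure_span_tensorProd_scalarMLPs (hσ : Continuous σ)
    (hna : ¬ ∃ a b : ℝ, ∀ t : ℝ, σ t = a * t + b) (n : ℕ) :
    (Submodule.span ℝ
      (tensorProd '' Set.univ.pi fun _ : Fin n => scalarMLPs σ)).topologicalClosure = ⊤ := by
  rw [← top_le_iff, ← topologicalClosure_span_range_tensorProd n]
  refine Submodule.topologicalClosure_minimal _ (Submodule.span_le.2 ?_)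
    (Submodule.isClosed_topologicalClosure _)
  rintro _ ⟨g, rfl⟩
  have hg : g ∈ closure
      (Set.univ.pi fun _ : Fin n =>
        (Submodule.span ℝ (scalarMLPs σ) : Set C(unitInterval, ℝ))) := by
    rw [closure_pi_set]
    intro i _
    have : g i ∈ (Submodule.span ℝ (scalarMLPs σ)).topologicalClosure :=
      topologicalClosure_span_scalarMLPs hσ hna ▸ trivial
    exact this
  refine map_mem_closure continuous_tensorProd hg fun h hh => ?_
  exact tensorProd_mem_span fun i => hh i trivial

end UnitInterval

/-- Neural Approximation Theorem. Let `σ : ℝ → ℝ` be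
continuous, not affine, and differentiable at some point with nonzero
derivative there. Then every continuous `ψ : [0,1]^n → ℝ` is uniformly
approximated within any `ε > 0` by a finite sum of block terms
`∑ j, ∑ k, C j k * ∏ i, (f j i (x i)) (k i)`, where each neural basis function
`f j i : [0,1] → ℝ^{R j i}` is a multilayer perceptron with activation `σ` and
the `C j` are coefficient tensors. -/
theorem neural_approximation (σ : ℝ → ℝ) (hσc : Continuous σ)
    (hσna : ¬ ∃ a b : ℝ, ∀ t : ℝ, σ t = a * t + b)
    (hσd : ∃ (x₀ d : ℝ), HasDerivAt σ d x₀ ∧ d ≠ 0)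
    (n : ℕ) (ψ : (Fin n → ℝ) → ℝ)
    (hψ : ContinuousOn ψ (Set.Icc (0 : Fin n → ℝ) 1))
    (ε : ℝ) (hε : 0 < ε) :
    ∃ (T : ℕ) (R : Fin T → Fin n → ℕ)
      (C : (j : Fin T) → (((i : Fin n) → Fin (R j i)) → ℝ))
      (f : (j : Fin T) → (i : Fin n) → (Fin 1 → ℝ) → (Fin (R j i) → ℝ)),
      (∀ j i, IsMLP σ (f j i)) ∧
      ∀ x ∈ Set.Icc (0 : Fin n → ℝ) 1,
        |ψ x - ∑ j, ∑ k : (i : Fin n) → Fin (R j i),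
            C j k * ∏ i, f j i (fun _ => x i) (k i)| < ε := by
  have hψc : Continuous (fun x : Set.Icc (0 : Fin n → ℝ) 1 => ψ x) :=
    continuousOn_iff_continuous_domRestrict.1 hψ
  have hmem : (⟨_, hψc⟩ : C(Set.Icc (0 : Fin n → ℝ) 1, ℝ)) ∈ (Submodule.span ℝ
      (tensorProd '' Set.univ.pi fun _ : Fin n => scalarMLPs σ)).topologicalClosure :=
    topologicalClosure_span_tensorProd_scalarMLPs hσc hσna n ▸ trivial
  obtain ⟨F, hFS, hF⟩ := Metric.mem_closure_iff.1 hmem ε hε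
  obtain ⟨T, c, p, rfl⟩ := Submodule.mem_span_set'.1 hFS
  choose g hg hgp using fun j => (p j).2
  choose s hs hgs using fun j i => hg j i trivial
  choose f hf hfs using hs
  refine ⟨T, fun _ _ => 1, fun j _ => c j, f, hf, fun x hx => ?_⟩
  have h1 := (ContinuousMap.dist_apply_le_dist (⟨x, hx⟩ : Set.Icc (0 : Fin n → ℝ) 1)).trans_lt hF
  rw [Real.dist_eq] at h1
  simpa [← hgp, tensorProd, cubeProj, hgs, hfs, ContinuousMap.prod_apply] using h1
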